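/- Let d, n ≥ 1 be integers and let A and B be measurable subsets of ℝ^d of finite positive Lebesgue measure. Let A' and B' be closed Euclidean balls in ℝ^d centred at the origin with |A'| = |A| and |B'| = |B|. Then for points b_1, …, b_n chosen independently and uniformly at random from B, and b'_1, …, b'_n chosen independently and uniformly at random from B', one has E(|⋃_{i=1}^n (A + b_i)|) ≥ E(|⋃_{i=1}^n (A' + b'_i)|). -/

import Mathlib

open MeasureTheory

/-- The expected volume of `⋃ i, (A i + b i)` when each `b i` is chosen independently
and uniformly at random from `B i`; it equals
`(∏ i |B i|)⁻¹ ∫_{B 1 × ⋯ × B n} |⋃ i (A i + b i)| db`. -/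
noncomputable def expUnion {d n : ℕ} (A B : Fin n → Set (EuclideanSpace ℝ (Fin d))) : ℝ :=
  ((∏ i, volume (B i))⁻¹ *
    ∫⁻ b in Set.univ.pi B, volume (⋃ i, (· + b i) '' (A i))).toReal

section Rearrangement

open Set Filter Topology
open scoped ENNReal

/-- The pairs in `X × Y` whose difference lies in `Z`. -/
def diffPairs {G : Type*} [Sub G] (X Y Z : Set G) : Set (G × G) :=
  {p | p.1 ∈ X ∧ p.2 ∈ Y ∧ p.1 - p.2 ∈ Z}

lemma measurableSet_diffPairs {G : Type*} [Sub G] [MeasurableSpace G] [MeasurableSub₂ G]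
    {X Y Z : Set G} (hX : MeasurableSet X) (hY : MeasurableSet Y) (hZ : MeasurableSet Z) :
    MeasurableSet (diffPairs X Y Z) :=
  (measurable_fst hX).inter ((measurable_snd hY).inter (measurable_sub hZ))

lemma exists_volume_inter_Iic_eq {X : Set ℝ} {t : ℝ≥0∞}
    (ht0 : 0 < t) (ht : t < volume X) (hXfin : volume X ≠ ∞) :
    ∃ α, volume (X ∩ Iic α) = t := by
  set μ := volume.restrict X
  have hμ : ∀ α, μ (Iic α) = volume (X ∩ Iic α) := fun α => by
    rw [Measure.restrict_apply measurableSet_Iic, inter_comm]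
  have hcont : Continuous fun α => volume (X ∩ Iic α) := by
    have hfin : ∀ α, volume (X ∩ Iic α) ≠ ∞ := fun α =>
      ne_top_of_le_ne_top hXfin (measure_mono inter_subset_left)
    have hstep : ∀ x y, x ≤ y →
        volume (X ∩ Iic y) ≤ volume (X ∩ Iic x) + ENNReal.ofReal (y - x) := by
      intro x y hxy
      rw [← Real.volume_Ioc, ← Iic_union_Ioc_eq_Iic hxy, inter_union_distrib_left]
      exact (measure_union_le _ _).trans (add_le_add le_rfl (measure_mono inter_subset_right))
    have hlip : LipschitzWith 1 fun α => (volume (X ∩ Iic α)).toReal := by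
      refine LipschitzWith.of_le_add fun x y => ?_
      have key : volume (X ∩ Iic x) ≤ volume (X ∩ Iic y) + ENNReal.ofReal (dist x y) := by
        rcases le_total x y with h | h
        · exact (measure_mono (inter_subset_inter_right _ (Iic_subset_Iic.2 h))).trans le_self_add
        · exact (hstep y x h).trans
            (add_le_add le_rfl (ENNReal.ofReal_le_ofReal (le_abs_self _)))
      have := ENNReal.toReal_mono (by simp [hfin]) key
      rwa [ENNReal.toReal_add (hfin _) ENNReal.ofReal_ne_top,
        ENNReal.toReal_ofReal dist_nonneg] at this
    refine (ENNReal.continuous_ofReal.comp hlip.continuous).congr fun α => ?_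
    simp [ENNReal.ofReal_toReal (hfin α)]
  refine mem_range_of_exists_le_of_exists_ge hcont ?_ ?_
  · have h : Tendsto (fun n : ℕ => μ (Iic (-(n : ℝ)))) atTop (𝓝 (μ (⋂ n : ℕ, Iic (-(n : ℝ))))) := by
      refine tendsto_measure_iInter_atTop (fun i => measurableSet_Iic.nullMeasurableSet) ?_ ?_
      · intro a b hab
        exact Iic_subset_Iic.2 (by simpa using hab)
      · exact ⟨0, ne_top_of_le_ne_top hXfin
          ((hμ _).trans_le (measure_mono inter_subset_left))⟩
    have h0 : (⋂ n : ℕ, Iic (-(n : ℝ))) = ∅ := by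
      ext x
      simp only [mem_iInter, mem_Iic, mem_empty_iff_false, iff_false, not_forall, not_le]
      obtain ⟨n, hn⟩ := exists_nat_gt (-x)
      exact ⟨n, by linarith⟩
    rw [h0, measure_empty] at h
    obtain ⟨n, hn⟩ := (h.eventually_lt_const ht0).exists
    exact ⟨_, (hμ _).symm.trans_le hn.le⟩
  · have h := tendsto_measure_Iic_atTop μ
    rw [Measure.restrict_apply_univ] at h
    obtain ⟨x, hx⟩ := (h.eventually_const_lt ht).exists
    exact ⟨x, hx.le.trans_eq (hμ x)⟩

lemma volume_diffPairs_le_of_threshold {X Y Z : Set ℝ} (hX : MeasurableSet X)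
    (hY : MeasurableSet Y) (hZ : MeasurableSet Z) {t : ℝ≥0∞}
    (ht0 : 0 < t) (htX : t < volume X) (htY : t < volume Y) (hXfin : volume X ≠ ∞)
    (hYfin : volume Y ≠ ∞) :
    volume (diffPairs X Y Z) ≤ (volume X - t) * (volume Y - t) + t * volume Z := by
  obtain ⟨α, hα⟩ := exists_volume_inter_Iic_eq ht0 htX hXfin
  obtain ⟨β, hβ⟩ := exists_volume_inter_Iic_eq ht0 htY hYfin
  have hIoi : ∀ {W : Set ℝ} {γ : ℝ}, MeasurableSet W → volume W ≠ ∞ → volume (W ∩ Iic γ) = t →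
      volume (W \ Iic γ) = volume W - t := by
    intro W γ hW hWfin h
    rw [← h, ← measure_inter_add_sdiff W (measurableSet_Iic (a := γ)),
      ENNReal.add_sub_cancel_left]
    exact ne_top_of_le_ne_top hWfin (measure_mono inter_subset_left)
  set G : Set (ℝ × ℝ) := {p | p.1 ∈ X ∧ p.2 ∈ Y ∧ p.1 - p.2 ∈ Z ∧ (p.1 ≤ α ∨ p.2 ≤ β)} with hG
  have hsub : diffPairs X Y Z ⊆ (X \ Iic α) ×ˢ (Y \ Iic β) ∪ G := by
    rintro ⟨x, y⟩ ⟨hx, hy, hz⟩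
    by_cases h : x ≤ α ∨ y ≤ β
    · exact Or.inr ⟨hx, hy, hz, h⟩
    · push Not at h
      exact Or.inl ⟨⟨hx, by simpa using h.1⟩, ⟨hy, by simpa using h.2⟩⟩
  refine (measure_mono hsub).trans ((measure_union_le _ _).trans (add_le_add ?_ ?_))
  · rw [Measure.volume_eq_prod, Measure.prod_prod, hIoi hX hXfin hα, hIoi hY hYfin hβ]
  · set H : Set (ℝ × ℝ) :=
      {q | q.1 ∈ Z ∧ q.1 + q.2 ∈ X ∧ q.2 ∈ Y ∧ (q.1 + q.2 ≤ α ∨ q.2 ≤ β)} with hH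
    have hHm : MeasurableSet H := by
      refine (measurable_fst hZ).inter ((measurable_add hX).inter ((measurable_snd hY).inter ?_))
      exact (measurableSet_le measurable_add measurable_const).union
        (measurableSet_le measurable_snd measurable_const)
    have hGH : G = (fun p : ℝ × ℝ => (p.1 - p.2, p.2)) ⁻¹' H := by
      ext ⟨x, y⟩
      simp only [hG, hH, mem_ofPred_eq, mem_preimage, sub_add_cancel]
      tauto
    rw [hGH, Measure.volume_eq_prod,
      (measurePreserving_sub_prod volume volume).measure_preimage hHm.nullMeasurableSet,
      Measure.prod_apply hHm]
    calc ∫⁻ z, volume (Prod.mk z ⁻¹' H) ≤ ∫⁻ z, Z.indicator (fun _ => t) z := by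
          refine lintegral_mono fun z => ?_
          by_cases hz : z ∈ Z
          · rw [indicator_of_mem hz]
            rcases le_total (α - z) β with h | h
            · rw [← hβ]
              refine measure_mono ?_
              rintro y ⟨-, -, hy, hy'⟩
              exact ⟨hy, hy'.elim (fun h' => by simp only at h'; exact mem_Iic.2 (by linarith)) id⟩
            · rw [← hα, ← measure_preimage_add volume z (X ∩ Iic α)]
              refine measure_mono ?_
              rintro y ⟨-, hx, -, hy'⟩
              exact ⟨hx, hy'.elim id (fun h' => by simp only at h'; exact mem_Iic.2 (by linarith))⟩
          · have : Prod.mk z ⁻¹' H = ∅ := by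
              ext y; simp [hH, hz]
            simp [this]
      _ = t * volume Z := by rw [lintegral_indicator_const hZ]

lemma volume_diffPairs_le_mul_left {X Y Z : Set ℝ} (hX : MeasurableSet X)
    (hZ : MeasurableSet Z) : volume (diffPairs X Y Z) ≤ volume X * volume Z := by
  have hsub : diffPairs X Y Z ⊆ (fun p : ℝ × ℝ => (p.1, p.2 - p.1)) ⁻¹' (X ×ˢ (-Z)) := by
    rintro ⟨x, y⟩ ⟨hx, -, hz⟩
    exact ⟨hx, by simpa using hz⟩
  refine (measure_mono hsub).trans ?_
  rw [Measure.volume_eq_prod, (measurePreserving_prod_sub volume volume).measure_preimage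
    (hX.prod hZ.neg).nullMeasurableSet, Measure.prod_prod, Measure.measure_neg]

lemma volume_diffPairs_le_mul_right {X Y Z : Set ℝ} (hY : MeasurableSet Y)
    (hZ : MeasurableSet Z) : volume (diffPairs X Y Z) ≤ volume Z * volume Y := by
  have hsub : diffPairs X Y Z ⊆ (fun p : ℝ × ℝ => (p.1 - p.2, p.2)) ⁻¹' (Z ×ˢ Y) := by
    rintro ⟨x, y⟩ ⟨-, hy, hz⟩
    exact ⟨hz, hy⟩
  refine (measure_mono hsub).trans ?_
  rw [Measure.volume_eq_prod, (measurePreserving_sub_prod volume volume).measure_preimage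
    (hZ.prod hY).nullMeasurableSet, Measure.prod_prod]

/-- The open interval centred at the origin of length `ℓ`. -/
def centeredInterval (ℓ : ℝ≥0∞) : Set ℝ := {t | 2 * ENNReal.ofReal |t| < ℓ}

lemma mem_centeredInterval {ℓ : ℝ≥0∞} {t : ℝ} :
    t ∈ centeredInterval ℓ ↔ 2 * ENNReal.ofReal |t| < ℓ := Iff.rfl

lemma measurableSet_centeredInterval (ℓ : ℝ≥0∞) : MeasurableSet (centeredInterval ℓ) :=
  measurableSet_lt (by fun_prop) measurable_const

lemma mem_centeredInterval_ofReal {m t : ℝ} :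
    t ∈ centeredInterval (ENNReal.ofReal m) ↔ 2 * |t| < m := by
  rw [mem_centeredInterval, show (2 : ℝ≥0∞) = ENNReal.ofReal 2 by simp,
    ← ENNReal.ofReal_mul two_pos.le, ENNReal.ofReal_lt_ofReal_iff']
  exact ⟨fun h => h.1, fun h => ⟨h, (by positivity : 0 ≤ 2 * |t|).trans_lt h⟩⟩

lemma volume_centeredInterval (ℓ : ℝ≥0∞) : volume (centeredInterval ℓ) = ℓ := by
  rcases eq_or_ne ℓ ∞ with rfl | hℓ
  · have : centeredInterval ∞ = univ := by
      ext t
      simp [centeredInterval, ENNReal.mul_lt_top_iff]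
    simp [this]
  · obtain ⟨m, hm, rfl⟩ : ∃ m : ℝ, 0 ≤ m ∧ ℓ = ENNReal.ofReal m :=
      ⟨ℓ.toReal, ENNReal.toReal_nonneg, (ENNReal.ofReal_toReal hℓ).symm⟩
    have : centeredInterval (ENNReal.ofReal m) = Ioo (-(m / 2)) (m / 2) := by
      ext t
      rw [mem_centeredInterval_ofReal, mem_Ioo, ← abs_lt, lt_div_iff₀' two_pos]
    rw [this, Real.volume_Ioo]
    congr 1; ring

lemma volume_triangle_le {a b c : ℝ} (h : b + c ≤ a) :
    volume {p : ℝ × ℝ | p.1 < a ∧ b < p.2 ∧ c ≤ p.1 - p.2} ≤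
      ENNReal.ofReal ((a - b - c) ^ 2 / 2) := by
  have hm : MeasurableSet {p : ℝ × ℝ | p.1 < a ∧ b < p.2 ∧ c ≤ p.1 - p.2} :=
    (measurableSet_lt measurable_fst measurable_const).inter
      ((measurableSet_lt measurable_const measurable_snd).inter
        (measurableSet_le measurable_const measurable_sub))
  rw [Measure.volume_eq_prod, Measure.prod_apply hm]
  calc _ ≤ ∫⁻ x, (Ioc (b + c) a).indicator (fun x => ENNReal.ofReal (x - (b + c))) x := by
        refine lintegral_mono fun x => ?_
        by_cases hx : x ∈ Ioc (b + c) a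
        · rw [indicator_of_mem hx]
          calc _ ≤ volume (Ioc b (x - c)) := measure_mono fun y hy =>
                ⟨hy.2.1, by have := hy.2.2; simp only at this; linarith⟩
            _ = _ := by rw [Real.volume_Ioc]; congr 1; ring
        · refine (measure_mono_null ?_ measure_empty).trans_le zero_le
          rintro y ⟨h1, h2, h3⟩
          simp only at h1 h2 h3
          exact hx ⟨by linarith, h1.le⟩
    _ = ∫⁻ x in Ioc (b + c) a, ENNReal.ofReal (x - (b + c)) :=
        lintegral_indicator measurableSet_Ioc _
    _ = ENNReal.ofReal (∫ x in (b + c)..a, (x - (b + c))) := by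
        rw [intervalIntegral.integral_of_le h, ofReal_integral_eq_lintegral_ofReal]
        · exact (Continuous.intervalIntegrable (by fun_prop) (b + c) a).1
        · exact (ae_restrict_iff' measurableSet_Ioc).2
            (Eventually.of_forall fun x hx => sub_nonneg.2 hx.1.le)
    _ ≤ _ := by
        refine ENNReal.ofReal_le_ofReal (le_of_eq ?_)
        rw [intervalIntegral.integral_sub (by simp) (by simp), integral_id,
          intervalIntegral.integral_const, smul_eq_mul]
        ring

lemma mul_le_volume_diffPairs_centeredInterval_add {m n γ : ℝ}
    (h : γ ≤ m + n) :
    ENNReal.ofReal m * ENNReal.ofReal n ≤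
      volume (diffPairs (centeredInterval (ENNReal.ofReal m))
        (centeredInterval (ENNReal.ofReal n)) (centeredInterval (ENNReal.ofReal γ))) +
      ENNReal.ofReal (((m + n - γ) / 2) ^ 2) := by
  set T₁ : Set (ℝ × ℝ) := {p | p.1 < m / 2 ∧ -n / 2 < p.2 ∧ γ / 2 ≤ p.1 - p.2}
  set T₂ : Set (ℝ × ℝ) := {p | p.1 < n / 2 ∧ -m / 2 < p.2 ∧ γ / 2 ≤ p.1 - p.2} with hT₂
  have hT₂m : MeasurableSet T₂ :=
    (measurableSet_lt measurable_fst measurable_const).inter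
      ((measurableSet_lt measurable_const measurable_snd).inter
        (measurableSet_le measurable_const measurable_sub))
  have h₁ : volume T₁ ≤ ENNReal.ofReal (((m + n - γ) / 2) ^ 2 / 2) := by
    refine (volume_triangle_le (by linarith)).trans_eq ?_
    congr 1; ring
  have h₂ : volume (Prod.swap ⁻¹' T₂) ≤ ENNReal.ofReal (((m + n - γ) / 2) ^ 2 / 2) := by
    rw [Measure.volume_eq_prod,
      Measure.measurePreserving_swap.measure_preimage hT₂m.nullMeasurableSet,
      ← Measure.volume_eq_prod]
    refine (volume_triangle_le (by linarith)).trans_eq ?_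
    congr 1; ring
  have hsub : centeredInterval (ENNReal.ofReal m) ×ˢ centeredInterval (ENNReal.ofReal n) ⊆
      diffPairs (centeredInterval (ENNReal.ofReal m))
        (centeredInterval (ENNReal.ofReal n)) (centeredInterval (ENNReal.ofReal γ)) ∪
      (T₁ ∪ Prod.swap ⁻¹' T₂) := by
    rintro ⟨x, y⟩ ⟨hx, hy⟩
    by_cases hz : x - y ∈ centeredInterval (ENNReal.ofReal γ)
    · exact Or.inl ⟨hx, hy, hz⟩
    · right
      simp only [mem_centeredInterval_ofReal, not_lt] at hx hy hz
      have hx' := abs_lt.1 ((lt_div_iff₀' two_pos).2 hx)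
      have hy' := abs_lt.1 ((lt_div_iff₀' two_pos).2 hy)
      rcases le_abs'.1 ((div_le_iff₀' two_pos).2 hz) with h' | h'
      · exact Or.inr ⟨hy'.2, by simp only [Prod.snd_swap]; linarith [hx'.1],
          by simp only [Prod.fst_swap, Prod.snd_swap]; linarith⟩
      · exact Or.inl ⟨hx'.2, by simp only; linarith [hy'.1], h'⟩
  calc _ = volume (centeredInterval (ENNReal.ofReal m) ×ˢ centeredInterval (ENNReal.ofReal n)) := by
        rw [Measure.volume_eq_prod, Measure.prod_prod, volume_centeredInterval,
          volume_centeredInterval]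
    _ ≤ _ := (measure_mono hsub).trans (measure_union_le _ _)
    _ ≤ _ := by
        refine add_le_add le_rfl ((measure_union_le _ _).trans ((add_le_add h₁ h₂).trans_eq ?_))
        rw [← ENNReal.ofReal_add (by positivity) (by positivity), add_halves]

/-- The one-dimensional Riesz rearrangement inequality for sets. -/
theorem volume_diffPairs_le_centeredInterval {X Y Z : Set ℝ} (hX : MeasurableSet X)
    (hY : MeasurableSet Y) (hZ : MeasurableSet Z) (hXfin : volume X ≠ ∞) (hYfin : volume Y ≠ ∞)
    (hZfin : volume Z ≠ ∞) :
    volume (diffPairs X Y Z) ≤ volume (diffPairs (centeredInterval (volume X))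
      (centeredInterval (volume Y)) (centeredInterval (volume Z))) := by
  obtain ⟨m, hm, hXm⟩ : ∃ m : ℝ, 0 ≤ m ∧ volume X = ENNReal.ofReal m :=
    ⟨_, ENNReal.toReal_nonneg, (ENNReal.ofReal_toReal hXfin).symm⟩
  obtain ⟨n, hn, hYn⟩ : ∃ m : ℝ, 0 ≤ m ∧ volume Y = ENNReal.ofReal m :=
    ⟨_, ENNReal.toReal_nonneg, (ENNReal.ofReal_toReal hYfin).symm⟩
  obtain ⟨γ, hγ, hZγ⟩ : ∃ m : ℝ, 0 ≤ m ∧ volume Z = ENNReal.ofReal m :=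
    ⟨_, ENNReal.toReal_nonneg, (ENNReal.ofReal_toReal hZfin).symm⟩
  by_cases h₁ : m + n ≤ γ
  · calc volume (diffPairs X Y Z) ≤ volume (X ×ˢ Y) := measure_mono fun p hp => ⟨hp.1, hp.2.1⟩
      _ = volume (centeredInterval (volume X) ×ˢ centeredInterval (volume Y)) := by
          simp only [Measure.volume_eq_prod, Measure.prod_prod, volume_centeredInterval]
      _ ≤ _ := by
          refine measure_mono ?_
          rintro ⟨x, y⟩ ⟨hx, hy⟩
          refine ⟨hx, hy, ?_⟩
          simp only [hXm, hYn, hZγ, mem_centeredInterval_ofReal] at hx hy ⊢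
          linarith [abs_sub x y]
  by_cases h₂ : m + γ ≤ n
  · refine (volume_diffPairs_le_mul_left hX hZ).trans ?_
    calc _ = volume ((fun p : ℝ × ℝ => (p.1, p.2 - p.1)) ⁻¹'
          (centeredInterval (volume X) ×ˢ centeredInterval (volume Z))) := by
          rw [Measure.volume_eq_prod,
            (measurePreserving_prod_sub volume volume).measure_preimage
              ((measurableSet_centeredInterval _).prod
                (measurableSet_centeredInterval _)).nullMeasurableSet,
            Measure.prod_prod, volume_centeredInterval, volume_centeredInterval]
      _ ≤ _ := by
          refine measure_mono ?_
          rintro ⟨x, y⟩ ⟨hx, hz⟩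
          refine ⟨hx, ?_⟩
          simp only [hXm, hYn, hZγ, mem_centeredInterval_ofReal] at hx hz ⊢
          rw [abs_sub_comm x y]
          exact ⟨by linarith [abs_add_le x (y - x), add_sub_cancel x y ▸ abs_add_le x (y - x)], hz⟩
  by_cases h₃ : n + γ ≤ m
  · refine (volume_diffPairs_le_mul_right hY hZ).trans ?_
    calc _ = volume ((fun p : ℝ × ℝ => (p.1 - p.2, p.2)) ⁻¹'
          (centeredInterval (volume Z) ×ˢ centeredInterval (volume Y))) := by
          rw [Measure.volume_eq_prod,
            (measurePreserving_sub_prod volume volume).measure_preimage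
              ((measurableSet_centeredInterval _).prod
                (measurableSet_centeredInterval _)).nullMeasurableSet,
            Measure.prod_prod, volume_centeredInterval, volume_centeredInterval]
      _ ≤ _ := by
          refine measure_mono ?_
          rintro ⟨x, y⟩ ⟨hz, hy⟩
          refine ⟨?_, hy, hz⟩
          simp only [hXm, hYn, hZγ, mem_centeredInterval_ofReal] at hy hz ⊢
          linarith [sub_add_cancel x y ▸ abs_add_le (x - y) y]
  push Not at h₁ h₂ h₃
  set t := (m + n - γ) / 2 with ht
  have ht0 : 0 < t := by linarith
  have hup := volume_diffPairs_le_of_threshold hX hY hZ (t := ENNReal.ofReal t) (by simpa)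
    (by rw [hXm]; exact (ENNReal.ofReal_lt_ofReal_iff (by linarith)).2 (by linarith))
    (by rw [hYn]; exact (ENNReal.ofReal_lt_ofReal_iff (by linarith)).2 (by linarith))
    hXfin hYfin
  have hlow := mul_le_volume_diffPairs_centeredInterval_add h₁.le
  rw [hXm, hYn, hZγ] at *
  rw [← ENNReal.ofReal_sub _ ht0.le, ← ENNReal.ofReal_sub _ ht0.le,
    ← ENNReal.ofReal_mul (by linarith), ← ENNReal.ofReal_mul ht0.le,
    ← ENNReal.ofReal_add (mul_nonneg (by linarith) (by linarith)) (by positivity)] at hup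
  rw [← ENNReal.ofReal_mul hm] at hlow
  refine hup.trans (le_trans (le_of_eq ?_) (tsub_le_iff_right.2 hlow))
  rw [← ENNReal.ofReal_sub _ (by positivity)]
  congr 1
  rw [show γ = m + n - 2 * t by rw [ht]; ring]
  ring

lemma volume_centeredInterval_inter {b : Set ℝ} (hb : ∀ s t : ℝ, |s| ≤ |t| → t ∈ b → s ∈ b)
    (ℓ : ℝ≥0∞) : volume (centeredInterval ℓ ∩ b) = min ℓ (volume b) := by
  have hnest : centeredInterval ℓ ⊆ b ∨ b ⊆ centeredInterval ℓ := by
    by_contra! h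
    obtain ⟨⟨s, hs, hsb⟩, ⟨t, htb, ht⟩⟩ := And.imp not_subset.1 not_subset.1 h
    rcases le_total |s| |t| with hst | hst
    · exact hsb (hb s t hst htb)
    · refine ht (mem_centeredInterval.2 (lt_of_le_of_lt ?_ (mem_centeredInterval.1 hs)))
      gcongr
  rcases hnest with h | h
  · rw [inter_eq_left.2 h, volume_centeredInterval, min_eq_left]
    exact (volume_centeredInterval ℓ).symm.trans_le (measure_mono h)
  · rw [inter_eq_right.2 h, min_eq_right]
    exact (measure_mono h).trans_eq (volume_centeredInterval ℓ)

lemma volume_inter_add_le_centeredInterval_inter {a b : Set ℝ} (ha : MeasurableSet a)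
    (hbm : MeasurableSet b) (hb : ∀ s t : ℝ, |s| ≤ |t| → t ∈ b → s ∈ b) (c : ℝ) :
    volume (a ∩ b) + volume ((a \ b) ∩ (· + c) ⁻¹' (b \ a)) ≤
      volume (centeredInterval (volume a) ∩ b) := by
  rw [volume_centeredInterval_inter hb, le_min_iff]
  constructor
  · rw [← measure_inter_add_sdiff a hbm]
    gcongr
    exact inter_subset_left
  · rw [← measure_inter_add_sdiff b ha, inter_comm b a,
      ← measure_preimage_add_right volume c (b \ a)]
    gcongr
    exact inter_subset_right

/-- The Steiner symmetrization of a set in the direction of the first factor. -/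
def steiner {F : Type*} (D : Set (ℝ × F)) : Set (ℝ × F) :=
  {x | x.1 ∈ centeredInterval (volume ((·, x.2) ⁻¹' D))}

lemma preimage_steiner {F : Type*} (D : Set (ℝ × F)) (p : F) :
    (·, p) ⁻¹' steiner D = centeredInterval (volume ((·, p) ⁻¹' D)) := rfl

section Steiner

variable {F : Type*} [MeasureSpace F]

lemma measurableSet_steiner {D : Set (ℝ × F)} (hD : MeasurableSet D) :
    MeasurableSet (steiner D) :=
  measurableSet_lt (by fun_prop) ((measurable_measure_prodMk_right hD).comp measurable_snd)

variable [SigmaFinite (volume : Measure F)]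

lemma volume_steiner {D : Set (ℝ × F)} (hD : MeasurableSet D) :
    volume (steiner D) = volume D := by
  rw [Measure.volume_eq_prod, Measure.prod_apply_symm (measurableSet_steiner hD),
    Measure.prod_apply_symm hD]
  exact lintegral_congr fun p => by rw [preimage_steiner, volume_centeredInterval]

lemma volume_inter_add_le_steiner_inter {D Q : Set (ℝ × F)} (hD : MeasurableSet D)
    (hQm : MeasurableSet Q) (hQ : ∀ p (s t : ℝ), |s| ≤ |t| → (t, p) ∈ Q → (s, p) ∈ Q) (c : ℝ) :
    volume (D ∩ Q) + volume ((D \ Q) ∩ (fun x : ℝ × F => (x.1 + c, x.2)) ⁻¹' (Q \ D)) ≤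
      volume (steiner D ∩ Q) := by
  have hm : MeasurableSet ((D \ Q) ∩ (fun x : ℝ × F => (x.1 + c, x.2)) ⁻¹' (Q \ D)) :=
    (hD.diff hQm).inter ((by fun_prop : Measurable fun x : ℝ × F => (x.1 + c, x.2)) (hQm.diff hD))
  rw [Measure.volume_eq_prod, Measure.prod_apply_symm (hD.inter hQm), Measure.prod_apply_symm hm,
    Measure.prod_apply_symm ((measurableSet_steiner hD).inter hQm),
    ← lintegral_add_left (measurable_measure_prodMk_right (hD.inter hQm))]
  exact lintegral_mono fun p => volume_inter_add_le_centeredInterval_inter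
    (measurable_prodMk_right hD) (measurable_prodMk_right hQm) (hQ p) c

lemma volume_prod_prod_eq_lintegral {S : Set ((ℝ × F) × (ℝ × F))} (hS : MeasurableSet S) :
    volume S = ∫⁻ p : F, ∫⁻ q : F,
      volume ((fun x : ℝ × ℝ => ((x.1, p), (x.2, q))) ⁻¹' S) := by
  have hG : Measurable fun z : ℝ × F => volume (Prod.mk z ⁻¹' S) :=
    measurable_measure_prodMk_left hS
  rw [Measure.volume_eq_prod, Measure.prod_apply hS]
  refine (lintegral_prod_symm' _ hG).trans ?_
  refine lintegral_congr fun p => ?_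
  have h₁ : ∀ s : ℝ, (volume.prod volume) (Prod.mk (s, p) ⁻¹' S) =
      ∫⁻ q : F, volume ((·, q) ⁻¹' (Prod.mk (s, p) ⁻¹' S)) := fun s =>
    Measure.prod_apply_symm (measurable_prodMk_left hS)
  have hS' : MeasurableSet ((fun x : (ℝ × F) × ℝ => ((x.1.1, p), (x.2, x.1.2))) ⁻¹' S) :=
    (by fun_prop : Measurable fun x : (ℝ × F) × ℝ => ((x.1.1, p), (x.2, x.1.2))) hS
  refine (lintegral_congr h₁).trans ?_
  rw [lintegral_lintegral_swap (measurable_measure_prodMk_left hS').aemeasurable]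
  refine lintegral_congr fun q => ?_
  rw [Measure.volume_eq_prod, Measure.prod_apply]
  · rfl
  · exact (by fun_prop : Measurable fun x : ℝ × ℝ => ((x.1, p), (x.2, q))) hS

lemma volume_diffPairs_le_steiner [AddGroup F] [MeasurableSub₂ F] {D₁ D₂ D₃ : Set (ℝ × F)}
    (h₁ : MeasurableSet D₁) (h₂ : MeasurableSet D₂) (h₃ : MeasurableSet D₃)
    (hf₁ : ∀ p, volume ((·, p) ⁻¹' D₁) ≠ ∞) (hf₂ : ∀ p, volume ((·, p) ⁻¹' D₂) ≠ ∞)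
    (hf₃ : ∀ p, volume ((·, p) ⁻¹' D₃) ≠ ∞) :
    volume (diffPairs D₁ D₂ D₃) ≤ volume (diffPairs (steiner D₁) (steiner D₂) (steiner D₃)) := by
  have : MeasurableSub₂ (ℝ × F) := ⟨Measurable.prodMk
    (measurable_fst.fst.sub measurable_snd.fst) (measurable_fst.snd.sub measurable_snd.snd)⟩
  rw [volume_prod_prod_eq_lintegral (measurableSet_diffPairs h₁ h₂ h₃),
    volume_prod_prod_eq_lintegral (measurableSet_diffPairs (measurableSet_steiner h₁)
      (measurableSet_steiner h₂) (measurableSet_steiner h₃))]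
  exact lintegral_mono fun p => lintegral_mono fun q => volume_diffPairs_le_centeredInterval
    (measurable_prodMk_right h₁) (measurable_prodMk_right h₂)
    (measurable_prodMk_right (y := p - q) h₃) (hf₁ p) (hf₂ q) (hf₃ (p - q))

end Steiner

section Euclidean

variable {E : Type*} [NormedAddCommGroup E] [InnerProductSpace ℝ E] [FiniteDimensional ℝ E]
  [MeasurableSpace E] [BorelSpace E]

lemma exists_measurableEquiv_prod_orthogonal {u : E} (hu : ‖u‖ = 1) :
    ∃ Ψ : ℝ × (ℝ ∙ u)ᗮ ≃ᵐ E, MeasurePreserving Ψ ∧ ∀ t p, Ψ (t, p) = t • u + (p : E) := by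
  let e : ℝ ≃ₗᵢ[ℝ] (ℝ ∙ u) := LinearIsometryEquiv.toSpanUnitSingleton u hu
  have he : MeasurePreserving e := e.measurePreserving
  let Ψ : ℝ × (ℝ ∙ u)ᗮ ≃ᵐ E :=
    ((MeasurableEquiv.prodCongr e.toMeasurableEquiv (MeasurableEquiv.refl _)).trans
      (MeasurableEquiv.toLp 2 _)).trans (ℝ ∙ u).orthogonalDecomposition.symm.toMeasurableEquiv
  refine ⟨Ψ, ?_, fun t p => ?_⟩
  · exact ((he.prod (MeasurePreserving.id volume)).trans
      (WithLp.volume_preserving_toLp _ _)).trans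
        (ℝ ∙ u).orthogonalDecomposition.symm.measurePreserving
  · change (ℝ ∙ u).orthogonalDecomposition.symm (WithLp.toLp 2 (e t, p)) = _
    simp [e]

/-- A Steiner symmetrization in the direction `u` does not decrease the number of pairs with
prescribed difference and moves sets towards balls centred at the origin. -/
lemma exists_symmetrization {u : E} (hu : ‖u‖ = 1) (R : ℝ) : ∃ S : Set E → Set E,
    (∀ A, MeasurableSet A → MeasurableSet (S A)) ∧
    (∀ A, MeasurableSet A → volume (S A) = volume A) ∧
    (∀ A, A ⊆ Metric.closedBall 0 R → S A ⊆ Metric.closedBall 0 R) ∧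
    (∀ A, MeasurableSet A → ∀ r c : ℝ,
      volume (A ∩ Metric.closedBall 0 r) + volume ((A \ Metric.closedBall 0 r) ∩
        (· + c • u) ⁻¹' (Metric.closedBall 0 r \ A)) ≤ volume (S A ∩ Metric.closedBall 0 r)) ∧
    (∀ A B C, MeasurableSet A → MeasurableSet B → MeasurableSet C →
      A ⊆ Metric.closedBall 0 R → B ⊆ Metric.closedBall 0 R → C ⊆ Metric.closedBall 0 R →
      volume (diffPairs A B C) ≤ volume (diffPairs (S A) (S B) (S C))) := by
  obtain ⟨Ψ, hΨ, hΨa⟩ := exists_measurableEquiv_prod_orthogonal hu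
  have hvol : ∀ A : Set E, volume (Ψ ⁻¹' A) = volume A := fun A => hΨ.measure_preimage_equiv A
  have hnorm : ∀ t p, ‖Ψ (t, p)‖ ^ 2 = t ^ 2 + ‖p‖ ^ 2 := by
    intro t p
    have hp : inner ℝ (t • u) (p : E) = 0 := by
      rw [inner_smul_left, Submodule.mem_orthogonal_singleton_iff_inner_right.1 p.2, mul_zero]
    rw [hΨa, sq, norm_add_sq_eq_norm_sq_add_norm_sq_of_inner_eq_zero _ _ hp, norm_smul, hu]
    simp [← sq]
  have hball : ∀ (r : ℝ) p (s t : ℝ), |s| ≤ |t| → (t, p) ∈ Ψ ⁻¹' Metric.closedBall 0 r →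
      (s, p) ∈ Ψ ⁻¹' Metric.closedBall 0 r := by
    intro r p s t hst ht
    rw [mem_preimage, mem_closedBall_zero_iff] at *
    refine le_trans (abs_le_of_sq_le_sq' ?_ (norm_nonneg _)).2 ht
    rw [hnorm, hnorm]
    linarith [sq_le_sq.2 hst]
  have hsec : ∀ (r : ℝ) p t, (t, p) ∉ Ψ ⁻¹' Metric.closedBall 0 r →
      volume ((·, p) ⁻¹' (Ψ ⁻¹' Metric.closedBall 0 r)) ≤ 2 * ENNReal.ofReal |t| := by
    intro r p t ht
    calc _ ≤ volume (Icc (-|t|) |t|) := measure_mono fun s hs => by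
          rw [mem_Icc, ← abs_le]
          by_contra! h
          exact ht (hball r p t s h.le hs)
      _ = _ := by
          rw [Real.volume_Icc, sub_neg_eq_add, ENNReal.ofReal_add (abs_nonneg _) (abs_nonneg _),
            two_mul]
  have hmem : ∀ (r : ℝ) p, ∃ t, (t, p) ∉ Ψ ⁻¹' Metric.closedBall 0 r := by
    intro r p
    refine ⟨|r| + 1, fun h => ?_⟩
    rw [mem_preimage, mem_closedBall_zero_iff] at h
    have h1 := hnorm (|r| + 1) p
    have h2 := pow_le_pow_left₀ (norm_nonneg _) (h.trans (le_abs_self r)) 2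
    nlinarith [sq_nonneg ‖p‖, abs_nonneg r]
  have hfin : ∀ A : Set E, A ⊆ Metric.closedBall 0 R → ∀ p, volume ((·, p) ⁻¹' (Ψ ⁻¹' A)) ≠ ∞ := by
    intro A hA p
    obtain ⟨t, ht⟩ := hmem R p
    refine ne_top_of_le_ne_top ?_
      ((measure_mono (preimage_mono (preimage_mono hA))).trans (hsec R p t ht))
    exact ENNReal.mul_ne_top (by simp) (by simp)
  have hS : ∀ A : Set E, Ψ ⁻¹' (Ψ.symm ⁻¹' steiner (Ψ ⁻¹' A)) = steiner (Ψ ⁻¹' A) := by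
    intro A; ext; simp
  refine ⟨fun A => Ψ.symm ⁻¹' steiner (Ψ ⁻¹' A), fun A hA => ?_, fun A hA => ?_, fun A hA => ?_,
    fun A hA r c => ?_, fun A B C hA hB hC hA' hB' hC' => ?_⟩
  · exact Ψ.symm.measurable (measurableSet_steiner (Ψ.measurable hA))
  · rw [← hvol, hS, volume_steiner (Ψ.measurable hA), hvol]
  · intro x hx
    obtain ⟨⟨t, p⟩, rfl⟩ := Ψ.surjective x
    rw [mem_preimage, Ψ.symm_apply_apply] at hx
    by_contra h
    exact lt_irrefl _ ((show 2 * ENNReal.ofReal |t| < _ from hx).trans_le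
      ((measure_mono (preimage_mono (preimage_mono hA))).trans (hsec R p t h)))
  · have h := volume_inter_add_le_steiner_inter (Ψ.measurable hA)
      (Ψ.measurable (Metric.isClosed_closedBall (x := (0 : E)) (ε := r)).measurableSet) (hball r) c
    rw [← hS A, ← preimage_inter, ← preimage_inter, hvol, hvol] at h
    refine le_trans (add_le_add le_rfl (le_of_eq ?_)) h
    rw [← hvol]
    congr 1
    ext ⟨t, p⟩
    have : Ψ (t, p) + c • u = Ψ (t + c, p) := by rw [hΨa, hΨa, add_smul]; abel
    simp only [mem_inter_iff, Set.mem_sdiff, mem_preimage, this]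
  · have hpull : ∀ A B C : Set E, MeasurableSet A → MeasurableSet B → MeasurableSet C →
        volume (diffPairs (Ψ ⁻¹' A) (Ψ ⁻¹' B) (Ψ ⁻¹' C)) = volume (diffPairs A B C) := by
      intro A B C hA hB hC
      refine Eq.trans ?_ ((hΨ.prod hΨ).measure_preimage
        (measurableSet_diffPairs hA hB hC).nullMeasurableSet)
      rw [← Measure.volume_eq_prod]
      congr 1
      ext ⟨⟨s, p⟩, ⟨t, q⟩⟩
      have : Ψ (s, p) - Ψ (t, q) = Ψ (s - t, p - q) := by
        simp only [hΨa, sub_smul, Submodule.coe_sub]; abel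
      simp [diffPairs, this]
    have hm : ∀ A : Set E, MeasurableSet A → MeasurableSet (Ψ.symm ⁻¹' steiner (Ψ ⁻¹' A)) :=
      fun A hA => Ψ.symm.measurable (measurableSet_steiner (Ψ.measurable hA))
    rw [← hpull A B C hA hB hC, ← hpull _ _ _ (hm A hA) (hm B hB) (hm C hC), hS, hS, hS]
    exact volume_diffPairs_le_steiner (Ψ.measurable hA) (Ψ.measurable hB) (Ψ.measurable hC)
      (hfin A hA') (hfin B hB') (hfin C hC')

lemma lintegral_volume_inter_preimage_add {P W : Set E} (hP : MeasurableSet P)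
    (hW : MeasurableSet W) :
    ∫⁻ v : E, volume (P ∩ (· + v) ⁻¹' W) = volume P * volume W := by
  have hm : MeasurableSet {p : E × E | p.2 ∈ P ∧ p.2 + p.1 ∈ W} :=
    (measurable_snd hP).inter ((by fun_prop : Measurable fun p : E × E => p.2 + p.1) hW)
  refine (Measure.prod_apply hm).symm.trans ((Measure.prod_apply_symm hm).trans ?_)
  calc _ = ∫⁻ x, P.indicator (fun _ => volume W) x := by
        refine lintegral_congr fun x => ?_
        by_cases hx : x ∈ P
        · rw [indicator_of_mem hx, ← measure_preimage_add volume x W]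
          congr 1
          ext v
          simp [hx]
        · rw [indicator_of_notMem hx]
          refine measure_mono_null (fun v hv => hx hv.1) measure_empty
    _ = _ := by rw [lintegral_indicator_const hP, mul_comm]

lemma volume_sdiff_comm {X Q : Set E} (hX : MeasurableSet X) (hQ : MeasurableSet Q)
    (h : volume X = volume Q) (hfin : volume X ≠ ∞) : volume (Q \ X) = volume (X \ Q) := by
  have h1 := measure_inter_add_sdiff (μ := volume) X hQ
  have h2 := measure_inter_add_sdiff (μ := volume) Q hX
  rw [← h, ← h1, inter_comm Q X] at h2
  exact (ENNReal.add_right_inj (ne_top_of_le_ne_top hfin (measure_mono inter_subset_left))).1 h2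

lemma volume_diffPairs_le_add {X Y Z X' Y' Z' : Set E} (hY : MeasurableSet Y)
    (hZ : MeasurableSet Z) (hZ' : MeasurableSet Z') :
    volume (diffPairs X Y Z) ≤ volume (diffPairs X' Y' Z') +
      (volume (X \ X') * volume Y + volume X * volume (Y \ Y') + volume (Z \ Z') * volume Y) := by
  have hsub : diffPairs X Y Z ⊆ diffPairs X' Y' Z' ∪ ((X \ X') ×ˢ Y ∪ X ×ˢ (Y \ Y') ∪
      (fun p : E × E => (p.1 - p.2, p.2)) ⁻¹' ((Z \ Z') ×ˢ Y)) := by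
    rintro ⟨x, y⟩ ⟨hx, hy, hz⟩
    by_cases hx' : x ∈ X'
    · by_cases hy' : y ∈ Y'
      · by_cases hz' : x - y ∈ Z'
        · exact Or.inl ⟨hx', hy', hz'⟩
        · exact Or.inr (Or.inr ⟨⟨hz, hz'⟩, hy⟩)
      · exact Or.inr (Or.inl (Or.inr ⟨hx, hy, hy'⟩))
    · exact Or.inr (Or.inl (Or.inl ⟨⟨hx, hx'⟩, hy⟩))
  refine (measure_mono hsub).trans ((measure_union_le _ _).trans (add_le_add le_rfl
    ((measure_union_le _ _).trans (add_le_add ((measure_union_le _ _).trans ?_) ?_))))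
  · simp [Measure.volume_eq_prod, Measure.prod_prod]
  · rw [Measure.volume_eq_prod, (measurePreserving_sub_prod volume volume).measure_preimage
      ((hZ.diff hZ').prod hY).nullMeasurableSet, Measure.prod_prod]

/-- The Riesz rearrangement inequality for bounded sets. -/
theorem volume_diffPairs_le_closedBall_of_subset {R : ℝ} {A : Fin 3 → Set E} {r : Fin 3 → ℝ}
    (hAm : ∀ i, MeasurableSet (A i)) (hAR : ∀ i, A i ⊆ Metric.closedBall 0 R)
    (hr : ∀ i, r i ≤ R) (hA : ∀ i, volume (A i) = volume (Metric.closedBall (0 : E) (r i))) :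
    volume (diffPairs (A 0) (A 1) (A 2)) ≤ volume (diffPairs (Metric.closedBall (0 : E) (r 0))
      (Metric.closedBall 0 (r 1)) (Metric.closedBall 0 (r 2))) := by
  set Q : Fin 3 → Set E := fun i => Metric.closedBall 0 (r i)
  set V : ℝ≥0∞ := volume (Metric.closedBall (0 : E) R)
  set K : ℝ≥0∞ := volume (Metric.closedBall (0 : E) (2 * R))
  have hV : V ≠ ∞ := measure_closedBall_lt_top.ne
  have hK : K ≠ ∞ := measure_closedBall_lt_top.ne
  have hQm : ∀ i, MeasurableSet (Q i) := fun i => Metric.isClosed_closedBall.measurableSet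
  let adm : Set (Fin 3 → Set E) := {X | (∀ i, MeasurableSet (X i)) ∧
    (∀ i, X i ⊆ Metric.closedBall 0 R) ∧ (∀ i, volume (X i) = volume (A i)) ∧
    volume (diffPairs (A 0) (A 1) (A 2)) ≤ volume (diffPairs (X 0) (X 1) (X 2))}
  have hAadm : A ∈ adm := ⟨hAm, hAR, fun _ => rfl, le_rfl⟩
  let J : (Fin 3 → Set E) → ℝ≥0∞ := fun X => ∑ i, volume (X i ∩ Q i)
  let gain : (Fin 3 → Set E) → E → ℝ≥0∞ := fun X v =>
    ∑ i, volume ((X i \ Q i) ∩ (· + v) ⁻¹' (Q i \ X i))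
  have hstep : ∀ X ∈ adm, ∀ v, ∃ X' ∈ adm, J X + gain X v ≤ J X' := by
    rintro X ⟨hXm, hXR, hXv, hXI⟩ v
    rcases eq_or_ne v 0 with rfl | hv
    · refine ⟨X, ⟨hXm, hXR, hXv, hXI⟩, ?_⟩
      have : gain X 0 = 0 := Finset.sum_eq_zero fun i _ =>
        measure_mono_null (fun x hx => hx.1.2 (by simpa using hx.2.1)) measure_empty
      simp [this]
    · obtain ⟨S, hSm, hSv, hSR, hSg, hSI⟩ := exists_symmetrization
        (u := ‖v‖⁻¹ • v) (norm_smul_inv_norm (𝕜 := ℝ) hv) R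
      refine ⟨fun i => S (X i), ⟨fun i => hSm _ (hXm i), fun i => hSR _ (hXR i),
        fun i => (hSv _ (hXm i)).trans (hXv i), hXI.trans
          (hSI _ _ _ (hXm 0) (hXm 1) (hXm 2) (hXR 0) (hXR 1) (hXR 2))⟩, ?_⟩
      rw [← Finset.sum_add_distrib]
      refine Finset.sum_le_sum fun i _ => ?_
      have := hSg (X i) (hXm i) (r i) ‖v‖
      rwa [smul_inv_smul₀ (norm_ne_zero_iff.2 hv)] at this
  have hJfin : ∀ X ∈ adm, J X ≤ 3 * V := by
    rintro X ⟨-, hXR, -⟩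
    refine (Finset.sum_le_sum fun i _ => measure_mono (inter_subset_left.trans (hXR i))).trans ?_
    simp [V]
  have hnear : ∀ η : ℝ≥0∞, η ≠ 0 → η ≠ ∞ → ∃ X ∈ adm, ∀ v, gain X v ≤ η := by
    intro η hη hηt
    set M := ⨆ X ∈ adm, J X
    have hM : M ≠ ∞ := ne_top_of_le_ne_top (ENNReal.mul_ne_top (by simp) hV) (iSup₂_le hJfin)
    obtain ⟨X, hX, hXM⟩ : ∃ X ∈ adm, M < J X + η := by
      by_contra! h
      have h1 : M ≤ M - η :=
        iSup₂_le fun X hX => ENNReal.le_sub_of_add_le_right hηt (h X hX)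
      have h0 : M ≠ 0 := fun h0 => hη (by simpa [h0] using h A hAadm : J A = 0 ∧ η = 0).2
      exact absurd h1 (ENNReal.sub_lt_self hM h0 hη).not_ge
    refine ⟨X, hX, fun v => ?_⟩
    obtain ⟨X', hX', hJ⟩ := hstep X hX v
    have hJX : J X ≠ ∞ := ne_top_of_le_ne_top (ENNReal.mul_ne_top (by simp) hV) (hJfin X hX)
    exact (ENNReal.add_le_add_iff_left hJX).1
      ((hJ.trans (le_iSup₂ (f := fun X _ => J X) X' hX')).trans hXM.le)
  have hclose : ∀ e : ℝ≥0∞, e ≠ 0 → e ≠ ∞ → ∃ X ∈ adm, ∀ i, volume (X i \ Q i) ≤ e := by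
    intro e he het
    obtain ⟨X, hX, hg⟩ := hnear (e * e / (K + 1))
      (ENNReal.div_pos (mul_ne_zero he he) (by simp [hK])).ne'
      (ENNReal.div_ne_top (ENNReal.mul_ne_top het het) (by simp))
    refine ⟨X, hX, fun i => ?_⟩
    obtain ⟨hXm, hXR, hXv, -⟩ := hX
    have hsq : volume (X i \ Q i) * volume (X i \ Q i) ≤ e * e := by
      calc _ = volume (X i \ Q i) * volume (Q i \ X i) := by
            rw [volume_sdiff_comm (hXm i) (hQm i) ((hXv i).trans (hA i))
              (ne_top_of_le_ne_top hV (measure_mono (hXR i)))]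
        _ = ∫⁻ v, volume ((X i \ Q i) ∩ (· + v) ⁻¹' (Q i \ X i)) :=
            (lintegral_volume_inter_preimage_add ((hXm i).diff (hQm i))
              ((hQm i).diff (hXm i))).symm
        _ ≤ ∫⁻ v, (Metric.closedBall (0 : E) (2 * R)).indicator
              (fun _ => e * e / (K + 1)) v := by
            refine lintegral_mono fun v => ?_
            by_cases hv : v ∈ Metric.closedBall (0 : E) (2 * R)
            · rw [indicator_of_mem hv]
              exact (Finset.single_le_sum (f := fun i =>
                volume ((X i \ Q i) ∩ (· + v) ⁻¹' (Q i \ X i))) (fun _ _ => zero_le)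
                (Finset.mem_univ i)).trans (hg v)
            · rw [indicator_of_notMem hv]
              refine (measure_mono_null (fun x hx => hv ?_) measure_empty).le
              have h1 := mem_closedBall_zero_iff.1 (hXR i hx.1.1)
              have h2 := (mem_closedBall_zero_iff.1 hx.2.1).trans (hr i)
              rw [mem_closedBall_zero_iff, show v = (x + v) - x by abel]
              linarith [norm_sub_le (x + v) x]
        _ = e * e / (K + 1) * K := by
            rw [lintegral_indicator_const Metric.isClosed_closedBall.measurableSet]
        _ ≤ e * e / (K + 1) * (K + 1) := by gcongr; exact le_self_add
        _ = e * e := ENNReal.div_mul_cancel (by simp) (by simp [hK])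
    by_contra! h
    exact absurd hsq (ENNReal.mul_lt_mul h h).not_ge
  refine ENNReal.le_of_forall_pos_le_add fun ε hε _ => ?_
  obtain ⟨X, ⟨hXm, hXR, hXv, hXI⟩, hX⟩ := hclose (ε / (3 * V + 1))
    (ENNReal.div_pos (by simpa using hε.ne') (by simp [hV, ENNReal.mul_eq_top])).ne'
    (ENNReal.div_ne_top (by simp) (by simp))
  have hXV : ∀ i, volume (X i) ≤ V := fun i => measure_mono (hXR i)
  refine hXI.trans ((volume_diffPairs_le_add (hXm 1) (hXm 2) (hQm 2)).trans
    (add_le_add le_rfl ?_) : _ ≤ volume (diffPairs (Q 0) (Q 1) (Q 2)) + _)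
  calc _ ≤ ε / (3 * V + 1) * V + V * (ε / (3 * V + 1)) + ε / (3 * V + 1) * V := by
        gcongr <;> first | exact hX _ | exact hXV _
    _ = ε / (3 * V + 1) * (3 * V) := by ring
    _ ≤ ε / (3 * V + 1) * (3 * V + 1) := by gcongr; exact le_self_add
    _ = ε := ENNReal.div_mul_cancel (by simp) (by simp [hV, ENNReal.mul_eq_top])

lemma exists_closedBall_volume_eq [Nontrivial E] {v : ℝ≥0∞} (hv : v ≠ ∞) :
    ∃ r : ℝ, 0 ≤ r ∧ volume (Metric.closedBall (0 : E) r) = v := by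
  have hω : volume (Metric.ball (0 : E) 1) ≠ 0 := (Metric.measure_ball_pos _ _ one_pos).ne'
  have hω' : volume (Metric.ball (0 : E) 1) ≠ ∞ := measure_ball_lt_top.ne
  have hd : Module.finrank ℝ E ≠ 0 := Module.finrank_pos.ne'
  refine ⟨((v / volume (Metric.ball (0 : E) 1)).toReal) ^ ((Module.finrank ℝ E : ℝ)⁻¹),
    by positivity, ?_⟩
  rw [Measure.addHaar_closedBall _ _ (by positivity),
    Real.rpow_inv_natCast_pow ENNReal.toReal_nonneg hd,
    ENNReal.ofReal_toReal (ENNReal.div_ne_top hv hω), ENNReal.div_mul_cancel hω hω']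

/-- The Riesz rearrangement inequality for sets of finite measure. -/
theorem volume_diffPairs_le_closedBall [Nontrivial E] {A : Fin 3 → Set E} {r : Fin 3 → ℝ}
    (hAm : ∀ i, MeasurableSet (A i)) (hr : ∀ i, 0 ≤ r i)
    (hA : ∀ i, volume (A i) = volume (Metric.closedBall (0 : E) (r i))) :
    volume (diffPairs (A 0) (A 1) (A 2)) ≤ volume (diffPairs (Metric.closedBall (0 : E) (r 0))
      (Metric.closedBall 0 (r 1)) (Metric.closedBall 0 (r 2))) := by
  let T : ℕ → Fin 3 → Set E := fun k i => A i ∩ Metric.closedBall 0 k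
  have hU : diffPairs (A 0) (A 1) (A 2) = ⋃ k, diffPairs (T k 0) (T k 1) (T k 2) := by
    ext ⟨x, y⟩
    rw [mem_iUnion]
    refine ⟨fun ⟨hx, hy, hz⟩ => ?_, fun ⟨k, hx, hy, hz⟩ => ⟨hx.1, hy.1, hz.1⟩⟩
    obtain ⟨k, hk⟩ := exists_nat_ge (‖x‖ + ‖y‖)
    have := norm_nonneg x
    have := norm_nonneg y
    have := norm_sub_le x y
    exact ⟨k, ⟨hx, mem_closedBall_zero_iff.2 (by linarith)⟩,
      ⟨hy, mem_closedBall_zero_iff.2 (by linarith)⟩,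
      ⟨hz, mem_closedBall_zero_iff.2 (by linarith)⟩⟩
  have hmono : Monotone fun k => diffPairs (T k 0) (T k 1) (T k 2) := by
    intro k l hkl p hp
    have h : ∀ i, T k i ⊆ T l i := fun i => inter_subset_inter_right _
      (Metric.closedBall_subset_closedBall (by exact_mod_cast hkl))
    exact ⟨h _ hp.1, h _ hp.2.1, h _ hp.2.2⟩
  rw [hU, hmono.measure_iUnion]
  refine iSup_le fun k => ?_
  have hTle : ∀ i, volume (T k i) ≤ volume (A i) := fun i => measure_mono inter_subset_left
  choose ρ hρ0 hρ using fun i =>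
    exists_closedBall_volume_eq (E := E) (ne_top_of_le_ne_top
      (measure_closedBall_lt_top.ne) ((hTle i).trans_eq (hA i)))
  have hsub : ∀ i, Metric.closedBall (0 : E) (ρ i) ⊆ Metric.closedBall 0 (r i) := by
    refine fun i => Metric.closedBall_subset_closedBall ?_
    have h := (hρ i).trans_le ((hTle i).trans_eq (hA i))
    rw [Measure.addHaar_closedBall _ _ (hρ0 i), Measure.addHaar_closedBall _ _ (hr i),
      ENNReal.mul_le_mul_iff_left (Metric.measure_ball_pos _ _ one_pos).ne' measure_ball_lt_top.ne,
      ENNReal.ofReal_le_ofReal_iff (pow_nonneg (hr i) _)] at h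
    exact le_of_pow_le_pow_left₀ Module.finrank_pos.ne' (hr i) h
  refine (volume_diffPairs_le_closedBall_of_subset (R := max k (max (ρ 0) (max (ρ 1) (ρ 2))))
    (fun i => (hAm i).inter Metric.isClosed_closedBall.measurableSet)
    (fun i => inter_subset_right.trans (Metric.closedBall_subset_closedBall (le_max_left _ _)))
    (fun i => ?_) (fun i => (hρ i).symm)).trans (measure_mono fun p hp =>
      ⟨hsub _ hp.1, hsub _ hp.2.1, hsub _ hp.2.2⟩)
  fin_cases i <;> simp

/-- The measure of the set of `y ∈ B` such that `x` lies in the translate of `A` by `y`. -/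
noncomputable def overlap (A B : Set E) (x : E) : ℝ≥0∞ := volume (B ∩ (fun y => x - y) ⁻¹' A)

lemma overlap_le (A B : Set E) (x : E) : overlap A B x ≤ volume B :=
  measure_mono inter_subset_left

lemma measurable_overlap {A B : Set E} (hA : MeasurableSet A) (hB : MeasurableSet B) :
    Measurable (overlap A B) := by
  have h : overlap A B = fun x => volume (Prod.mk x ⁻¹' diffPairs univ B A) := by
    funext x
    rw [overlap]
    congr 1
    ext y
    simp [diffPairs]
  rw [h]
  exact measurable_measure_prodMk_left (measurableSet_diffPairs MeasurableSet.univ hB hA)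

lemma setLIntegral_overlap {A B C : Set E} (hA : MeasurableSet A) (hB : MeasurableSet B)
    (hC : MeasurableSet C) : ∫⁻ x in C, overlap A B x = volume (diffPairs C B A) := by
  rw [Measure.volume_eq_prod, Measure.prod_apply (measurableSet_diffPairs hC hB hA),
    ← lintegral_indicator hC]
  refine lintegral_congr fun x => ?_
  by_cases hx : x ∈ C
  · rw [indicator_of_mem hx, overlap]
    congr 1
    ext y
    simp [diffPairs, hx]
  · rw [indicator_of_notMem hx]
    exact (measure_mono_null (fun y hy => hx hy.1) measure_empty).symm

lemma lintegral_overlap {A B : Set E} (hA : MeasurableSet A) (hB : MeasurableSet B) :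
    ∫⁻ x, overlap A B x = volume A * volume B := by
  rw [← setLIntegral_univ, setLIntegral_overlap hA hB MeasurableSet.univ, ← Measure.prod_prod,
    ← (measurePreserving_sub_prod volume volume).measure_preimage (hA.prod hB).nullMeasurableSet,
    ← Measure.volume_eq_prod]
  congr 1
  ext p
  simp [diffPairs, and_comm]

lemma lintegral_overlap_tsub_le [Nontrivial E] {A B : Set E} {r s : ℝ} (hA : MeasurableSet A)
    (hB : MeasurableSet B) (hr : 0 ≤ r) (hs : 0 ≤ s)
    (hvA : volume A = volume (Metric.closedBall (0 : E) r))
    (hvB : volume B = volume (Metric.closedBall (0 : E) s)) {t : ℝ≥0∞} (ht : t ≠ 0)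
    (ht' : t ≠ ∞) :
    ∫⁻ x, (overlap A B x - t) ≤
      ∫⁻ x, (overlap (Metric.closedBall (0 : E) r) (Metric.closedBall 0 s) x - t) := by
  have hg := measurable_overlap hA hB
  set C : Set E := {x | t < overlap A B x}
  have hC : MeasurableSet C := measurableSet_lt measurable_const hg
  have hCfin : volume C ≠ ∞ := by
    refine ne_top_of_le_ne_top ?_ ((measure_mono fun x (hx : t < _) => hx.le).trans
      (meas_ge_le_lintegral_div hg.aemeasurable ht ht'))
    rw [lintegral_overlap hA hB, hvA, hvB]
    exact ENNReal.div_ne_top (ENNReal.mul_ne_top measure_closedBall_lt_top.ne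
      measure_closedBall_lt_top.ne) ht
  obtain ⟨c, hc, hcv⟩ := exists_closedBall_volume_eq (E := E) hCfin
  have hriesz := volume_diffPairs_le_closedBall (A := ![C, B, A]) (r := ![c, s, r])
    (by simp [Fin.forall_fin_succ, *]) (by simp [Fin.forall_fin_succ, *])
    (by simp [Fin.forall_fin_succ, *])
  have hball : ∀ ρ : ℝ, MeasurableSet (Metric.closedBall (0 : E) ρ) := fun ρ =>
    Metric.isClosed_closedBall.measurableSet
  refine (ENNReal.add_le_add_iff_right (ENNReal.mul_ne_top ht' hCfin)).1 ?_
  calc (∫⁻ x, (overlap A B x - t)) + t * volume C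
      = (∫⁻ x in C, (overlap A B x - t)) + ∫⁻ x in C, t := by
        rw [setLIntegral_const, setLIntegral_eq_of_support_subset]
        exact fun x hx => tsub_pos_iff_lt.1 (pos_iff_ne_zero.2 hx)
    _ = ∫⁻ x in C, overlap A B x := by
        rw [← lintegral_add_right _ measurable_const]
        exact setLIntegral_congr_fun hC fun x (hx : t < _) => tsub_add_cancel_of_le hx.le
    _ ≤ ∫⁻ x in Metric.closedBall 0 c,
          overlap (Metric.closedBall (0 : E) r) (Metric.closedBall 0 s) x := by
        rw [setLIntegral_overlap hA hB hC, setLIntegral_overlap (hball r) (hball s) (hball c)]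
        exact hriesz
    _ ≤ ∫⁻ x in Metric.closedBall 0 c,
          (overlap (Metric.closedBall (0 : E) r) (Metric.closedBall 0 s) x - t + t) :=
        lintegral_mono fun x => le_tsub_add
    _ ≤ _ := by
        rw [lintegral_add_right _ measurable_const, setLIntegral_const, hcv]
        exact add_le_add (lintegral_mono' Measure.restrict_le_self le_rfl) le_rfl

lemma tsub_pow_add_lintegral {b s : ℝ≥0∞} (hb : b ≠ ∞) (hs : s ≤ b) (m : ℕ) :
    b ^ (m + 1) - (b - s) ^ (m + 1) + ∫⁻ t in Ioc 0 b.toReal, (s - ENNReal.ofReal t) *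
      ENNReal.ofReal ((m + 1) * m * (b.toReal - t) ^ (m - 1)) = (m + 1) * b ^ m * s := by
  lift b to NNReal using hb
  lift s to NNReal using ne_top_of_le_ne_top ENNReal.coe_ne_top hs
  rw [ENNReal.coe_le_coe] at hs
  have hs' : (s : ℝ) ≤ b := hs
  set w : ℝ → ℝ := fun t => (m + 1) * m * (b - t) ^ (m - 1)
  have hderiv : ∀ t : ℝ, HasDerivAt
      (fun t : ℝ => -m * (b - t) ^ (m + 1) + (m + 1) * (b - s) * (b - t) ^ m)
      ((s - t) * w t) t := by
    intro t
    have h : HasDerivAt (fun t : ℝ => (b : ℝ) - t) (-1) t := (hasDerivAt_id t).const_sub _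
    refine (((h.fun_pow (m + 1)).const_mul (-m : ℝ)).fun_add
      ((h.fun_pow m).const_mul ((m + 1) * (b - s) : ℝ))).congr_deriv ?_
    rcases m with _ | m
    · simp [w]
    · simp only [w, Nat.add_sub_cancel]
      push_cast
      ring
  have hint : ∫ t in (0 : ℝ)..s, (s - t) * w t =
      (b - s) ^ (m + 1) - b ^ (m + 1) + (m + 1) * b ^ m * s := by
    rw [intervalIntegral.integral_eq_sub_of_hasDerivAt (fun t _ => hderiv t)
      (Continuous.intervalIntegrable (by fun_prop) _ _)]
    ring
  have hnn : ∀ t ∈ Ioc (0 : ℝ) s, 0 ≤ (s - t) * w t := fun t ht =>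
    mul_nonneg (by linarith [ht.2]) (mul_nonneg (by positivity)
      (pow_nonneg (by linarith [ht.2]) _))
  have hnn' : 0 ≤ ∫ t in (0 : ℝ)..s, (s - t) * w t := by
    rw [intervalIntegral.integral_of_le s.coe_nonneg]
    exact setIntegral_nonneg measurableSet_Ioc hnn
  have hlint : ∫⁻ t in Ioc (0 : ℝ) b, ((s : ℝ≥0∞) - ENNReal.ofReal t) * ENNReal.ofReal (w t) =
      ENNReal.ofReal ((b - s) ^ (m + 1) - b ^ (m + 1) + (m + 1) * b ^ m * s) := by
    rw [← hint, intervalIntegral.integral_of_le s.coe_nonneg, ofReal_integral_eq_lintegral_ofReal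
      ((Continuous.intervalIntegrable (by fun_prop) _ _).1)
      ((ae_restrict_iff' measurableSet_Ioc).2 (ae_of_all _ hnn)),
      ← lintegral_indicator measurableSet_Ioc, ← lintegral_indicator measurableSet_Ioc]
    refine lintegral_congr fun t => ?_
    by_cases ht : t ∈ Ioc (0 : ℝ) s
    · rw [indicator_of_mem ht,
        indicator_of_mem (show t ∈ Ioc (0 : ℝ) b from ⟨ht.1, ht.2.trans hs'⟩),
        ENNReal.ofReal_mul (p := s - t) (by linarith [ht.2]), ENNReal.ofReal_sub _ ht.1.le,
        ENNReal.ofReal_coe_nnreal]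
    · rw [indicator_of_notMem ht]
      by_cases ht' : t ∈ Ioc (0 : ℝ) b
      · rw [indicator_of_mem ht', tsub_eq_zero_of_le, zero_mul]
        rw [← ENNReal.ofReal_coe_nnreal]
        refine ENNReal.ofReal_le_ofReal ?_
        by_contra! h
        exact ht ⟨ht'.1, h.le⟩
      · rw [indicator_of_notMem ht']
  rw [ENNReal.coe_toReal, hlint]
  rw [hint] at hnn'
  have h1 : (b : ℝ≥0∞) ^ (m + 1) - (b - s) ^ (m + 1) =
      ENNReal.ofReal (b ^ (m + 1) - (b - s) ^ (m + 1)) := by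
    rw [ENNReal.ofReal_sub _ (pow_nonneg (by linarith) _), ENNReal.ofReal_pow b.coe_nonneg,
      ENNReal.ofReal_pow (by linarith), ENNReal.ofReal_sub _ s.coe_nonneg]
    simp
  rw [h1, ← ENNReal.ofReal_add (sub_nonneg.2 (pow_le_pow_left₀ (by linarith)
    (by linarith [s.coe_nonneg]) _)) hnn',
    ← ENNReal.ofReal_coe_nnreal (p := b), ← ENNReal.ofReal_coe_nnreal (p := s),
    ← ENNReal.ofReal_pow b.coe_nonneg, show (m + 1 : ℝ≥0∞) = ENNReal.ofReal (m + 1) by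
      rw [ENNReal.ofReal_add (by positivity) (by positivity)]; simp,
    ← ENNReal.ofReal_mul (by positivity), ← ENNReal.ofReal_mul (by positivity)]
  congr 1
  ring

lemma lintegral_tsub_pow_overlap_add {A B : Set E} (hA : MeasurableSet A)
    (hB : MeasurableSet B) (hfin : volume B ≠ ∞) (m : ℕ) :
    (∫⁻ x, (volume B ^ (m + 1) - (volume B - overlap A B x) ^ (m + 1))) +
      ∫⁻ t in Ioc 0 (volume B).toReal, (∫⁻ x, (overlap A B x - ENNReal.ofReal t)) *
        ENNReal.ofReal ((m + 1) * m * ((volume B).toReal - t) ^ (m - 1)) =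
      (m + 1) * volume B ^ m * (volume A * volume B) := by
  have hg := measurable_overlap hA hB
  have hswap : ∫⁻ x, ∫⁻ t in Ioc 0 (volume B).toReal, (overlap A B x - ENNReal.ofReal t) *
      ENNReal.ofReal ((m + 1) * m * ((volume B).toReal - t) ^ (m - 1)) =
      ∫⁻ t in Ioc 0 (volume B).toReal, (∫⁻ x, (overlap A B x - ENNReal.ofReal t)) *
        ENNReal.ofReal ((m + 1) * m * ((volume B).toReal - t) ^ (m - 1)) :=
    (lintegral_lintegral_swap (Measurable.aemeasurable (by fun_prop))).trans
      (lintegral_congr fun t => lintegral_mul_const _ (by fun_prop))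
  rw [← hswap, ← lintegral_add_left (by fun_prop), ← lintegral_overlap hA hB,
    ← lintegral_const_mul _ hg]
  exact lintegral_congr fun x => tsub_pow_add_lintegral hfin (overlap_le A B x) m

lemma lintegral_tsub_pow_overlap_ne_top {A B : Set E} (hA : MeasurableSet A)
    (hB : MeasurableSet B) (hA' : volume A ≠ ∞) (hB' : volume B ≠ ∞) (m : ℕ) :
    ∫⁻ x, (volume B ^ (m + 1) - (volume B - overlap A B x) ^ (m + 1)) ≠ ∞ :=
  ne_top_of_le_ne_top (by finiteness)
    (le_self_add.trans_eq (lintegral_tsub_pow_overlap_add hA hB hB' m))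

lemma lintegral_tsub_pow_overlap_le [Nontrivial E] {A B : Set E} {r s : ℝ}
    (hA : MeasurableSet A) (hB : MeasurableSet B) (hr : 0 ≤ r) (hs : 0 ≤ s)
    (hvA : volume A = volume (Metric.closedBall (0 : E) r))
    (hvB : volume B = volume (Metric.closedBall (0 : E) s)) (m : ℕ) :
    ∫⁻ x, (volume B ^ (m + 1) - (volume B -
        overlap (Metric.closedBall (0 : E) r) (Metric.closedBall 0 s) x) ^ (m + 1)) ≤
      ∫⁻ x, (volume B ^ (m + 1) - (volume B - overlap A B x) ^ (m + 1)) := by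
  have hball : ∀ ρ : ℝ, MeasurableSet (Metric.closedBall (0 : E) ρ) := fun ρ =>
    Metric.isClosed_closedBall.measurableSet
  have hA' : volume A ≠ ∞ := hvA ▸ measure_closedBall_lt_top.ne
  have hB' : volume B ≠ ∞ := hvB ▸ measure_closedBall_lt_top.ne
  have h1 := lintegral_tsub_pow_overlap_add hA hB hB' m
  have h2 := lintegral_tsub_pow_overlap_add (hball r) (hball s) (hvB ▸ hB') m
  rw [← hvA, ← hvB] at h2
  have hP := ne_top_of_le_ne_top (by finiteness) (le_add_self.trans_eq h2)
  refine (ENNReal.add_le_add_iff_right hP).1 ((h2.trans h1.symm).trans_le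
    (add_le_add le_rfl (setLIntegral_mono' measurableSet_Ioc fun t ht => ?_)))
  exact mul_le_mul' (lintegral_overlap_tsub_le hA hB hr hs hvA hvB
    (ENNReal.ofReal_pos.2 ht.1).ne' ENNReal.ofReal_ne_top) le_rfl

lemma lintegral_volume_iUnion_translates {A B : Set E} (hA : MeasurableSet A)
    (hB : MeasurableSet B) (hfin : volume B ≠ ∞) (n : ℕ) :
    ∫⁻ b in univ.pi fun _ : Fin n => B, volume (⋃ i, (· + b i) '' A) =
      ∫⁻ x, (volume B ^ n - (volume B - overlap A B x) ^ n) := by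
  have hU : MeasurableSet {p : (Fin n → E) × E | ∃ i, p.2 - p.1 i ∈ A} := by
    rw [ofPred_exists]
    exact MeasurableSet.iUnion fun i =>
      (by fun_prop : Measurable fun p : (Fin n → E) × E => p.2 - p.1 i) hA
  have himage : ∀ b : Fin n → E, ⋃ i, (· + b i) '' A =
      Prod.mk b ⁻¹' {p : (Fin n → E) × E | ∃ i, p.2 - p.1 i ∈ A} := by
    intro b
    ext x
    simp [sub_eq_add_neg]
  simp_rw [himage]
  rw [← Measure.prod_apply hU, Measure.prod_apply_symm hU]
  refine lintegral_congr fun x => ?_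
  have hm : MeasurableSet ((fun y => x - y) ⁻¹' A) :=
    (by fun_prop : Measurable fun y : E => x - y) hA
  have hpi : ∀ D : Set E, volume (univ.pi fun _ : Fin n => D) = volume D ^ n := fun D => by
    simp [volume_pi_pi]
  have hdiff : volume (B \ (fun y => x - y) ⁻¹' A) = volume B - overlap A B x := by
    rw [← sdiff_inter_self_eq_sdiff, inter_comm, measure_sdiff inter_subset_left
      (hB.inter hm).nullMeasurableSet (ne_top_of_le_ne_top hfin (overlap_le A B x)), overlap]
  rw [Measure.restrict_apply (measurable_prodMk_right hU), ← hdiff, ← hpi, ← hpi,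
    ← measure_sdiff (pi_mono fun _ _ => sdiff_subset)
      (MeasurableSet.univ_pi fun _ => hB.diff hm).nullMeasurableSet
      (by
        rw [hpi]
        exact ENNReal.pow_ne_top (ne_top_of_le_ne_top hfin (measure_mono sdiff_subset)))]
  congr 1
  ext b
  simp only [mem_inter_iff, mem_preimage, Set.mem_ofPred_eq, Set.mem_sdiff, mem_univ_pi]
  constructor
  · rintro ⟨⟨i, hi⟩, hb⟩
    exact ⟨hb, fun h => (h i).2 hi⟩
  · rintro ⟨hb, h⟩
    push Not at h
    exact ⟨h.imp fun i hi => hi (hb i), hb⟩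

end Euclidean

end Rearrangement

theorem stmt0 (d n : ℕ) (hd : 1 ≤ d) (hn : 1 ≤ n)
    (A B : Set (EuclideanSpace ℝ (Fin d)))
    (hAm : MeasurableSet A) (hBm : MeasurableSet B)
    (hA0 : 0 < volume A) (hA1 : volume A < ⊤)
    (hB0 : 0 < volume B) (hB1 : volume B < ⊤)
    (r s : ℝ) (hr : 0 ≤ r) (hs : 0 ≤ s)
    (hvA : volume (Metric.closedBall (0 : EuclideanSpace ℝ (Fin d)) r) = volume A)
    (hvB : volume (Metric.closedBall (0 : EuclideanSpace ℝ (Fin d)) s) = volume B) :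
    expUnion (fun _ : Fin n => A) (fun _ => B) ≥
      expUnion (fun _ : Fin n => Metric.closedBall (0 : EuclideanSpace ℝ (Fin d)) r)
        (fun _ => Metric.closedBall 0 s) := by
  have : Nonempty (Fin d) := ⟨⟨0, hd⟩⟩
  obtain ⟨m, rfl⟩ := Nat.exists_eq_add_of_le' hn
  have hball : ∀ ρ : ℝ, MeasurableSet (Metric.closedBall (0 : EuclideanSpace ℝ (Fin d)) ρ) :=
    fun ρ => Metric.isClosed_closedBall.measurableSet
  have hle := lintegral_tsub_pow_overlap_le hAm hBm hr hs hvA.symm hvB.symm m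
  have hfin := lintegral_tsub_pow_overlap_ne_top hAm hBm hA1.ne hB1.ne m
  rw [ge_iff_le, expUnion, expUnion, lintegral_volume_iUnion_translates hAm hBm hB1.ne,
    lintegral_volume_iUnion_translates (hball r) (hball s) (hvB ▸ hB1.ne), hvB]
  refine ENNReal.toReal_mono (ENNReal.mul_ne_top ?_ hfin) (by gcongr)
  simp [Finset.prod_const, hB0.ne']
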